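/- arXiv:2212.07137 — 2 statements merged into one kernel-verified Lean document; each statement's English description precedes it below -/
import Mathlib

section
/- The orthogonal projections onto the deficiency subspaces ker(A* − iε) and ker(A* + iε) converge to the orthogonal projection onto ker A* in operator norm as ε → 0⁺. -/
open Complex Filter
open scoped ComplexInnerProductSpace

noncomputable section

variable {H : Type*} [NormedAddCommGroup H] [InnerProductSpace ℂ H] [CompleteSpace H]

/-- The eigenspace `ker (T - z·1)` of a partially defined linear operator `T`. -/
def pKer (T : H →ₗ.[ℂ] H) (z : ℂ) : Submodule ℂ H where
  carrier := {u : H | ∃ hu : u ∈ T.domain, T ⟨u, hu⟩ = z • u}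
  zero_mem' := ⟨T.domain.zero_mem, by
    have h0 : (⟨0, T.domain.zero_mem⟩ : T.domain) = 0 := rfl
    rw [h0, T.map_zero, smul_zero]⟩
  add_mem' := by
    rintro a b ⟨ha, hTa⟩ ⟨hb, hTb⟩
    refine ⟨T.domain.add_mem ha hb, ?_⟩
    have h : (⟨a + b, T.domain.add_mem ha hb⟩ : T.domain) = ⟨a, ha⟩ + ⟨b, hb⟩ := rfl
    rw [h, T.map_add, hTa, hTb, smul_add]
  smul_mem' := by
    rintro c a ⟨ha, hTa⟩
    refine ⟨T.domain.smul_mem c ha, ?_⟩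
    have h : (⟨c • a, T.domain.smul_mem c ha⟩ : T.domain) = c • (⟨a, ha⟩ : T.domain) := rfl
    rw [h, T.map_smul, hTa, smul_comm]

/-- Orthogonal projection onto a closed submodule, as a map `H →L[ℂ] H`. -/
def projCl (W : Submodule ℂ H) (hW : IsClosed (W : Set H)) : H →L[ℂ] H :=
  letI : CompleteSpace W := hW.completeSpace_coe
  W.subtypeL.comp (Submodule.orthogonalProjectionOnto W)

/-- The boundary map `Γ₁ε⁻ g = P_{ker(T - iε)} (T g + iε g)`. -/
def Gamma1m (T : H →ₗ.[ℂ] H) (hker : ∀ z : ℂ, IsClosed ((pKer T z : Set H)))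
    (ε : ℝ) (g : T.domain) : H :=
  projCl (pKer T ((ε : ℂ) * I)) (hker _) (T g + ((ε : ℂ) * I) • (g : H))

/-- The boundary map `Γ₁ε⁺ g = P_{ker(T + iε)} (T g - iε g)`. -/
def Gamma1p (T : H →ₗ.[ℂ] H) (hker : ∀ z : ℂ, IsClosed ((pKer T z : Set H)))
    (ε : ℝ) (g : T.domain) : H :=
  projCl (pKer T (-((ε : ℂ) * I))) (hker _) (T g - ((ε : ℂ) * I) • (g : H))

/-- The map `Υε g = (2iε)⁻¹ (Γ₁ε⁻ g - Γ₁ε⁺ g)`. -/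
def Ups (T : H →ₗ.[ℂ] H) (hker : ∀ z : ℂ, IsClosed ((pKer T z : Set H)))
    (ε : ℝ) (g : T.domain) : H :=
  (2 * (ε : ℂ) * I)⁻¹ • (Gamma1m T hker ε g - Gamma1p T hker ε g)

theorem projCl_mem (W : Submodule ℂ H) (hW : IsClosed (W : Set H)) (x : H) :
    projCl W hW x ∈ W := by
  simp [projCl]

theorem sub_projCl_mem_orthogonal (W : Submodule ℂ H) (hW : IsClosed (W : Set H)) (x : H) :
    x - projCl W hW x ∈ Wᗮ := by
  let : CompleteSpace W := hW.completeSpace_coe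
  exact W.sub_starProjection_mem_orthogonal x

theorem norm_sub_projCl_le (W : Submodule ℂ H) (hW : IsClosed (W : Set H)) (x : H) :
    ‖x - projCl W hW x‖ ≤ ‖x‖ := by
  have h := norm_add_sq_eq_norm_sq_add_norm_sq_of_inner_eq_zero (𝕜 := ℂ) _ _
    (sub_projCl_mem_orthogonal W hW x _ (projCl_mem W hW x))
  rw [add_sub_cancel] at h
  nlinarith [norm_nonneg x, norm_nonneg (x - projCl W hW x), norm_nonneg (projCl W hW x)]

theorem norm_projCl_le (W : Submodule ℂ H) (hW : IsClosed (W : Set H)) (x : H) :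
    ‖projCl W hW x‖ ≤ ‖x‖ := by
  have h := norm_add_sq_eq_norm_sq_add_norm_sq_of_inner_eq_zero (𝕜 := ℂ) _ _
    (sub_projCl_mem_orthogonal W hW x _ (projCl_mem W hW x))
  rw [add_sub_cancel] at h
  nlinarith [norm_nonneg x, norm_nonneg (x - projCl W hW x), norm_nonneg (projCl W hW x)]

/-- Two closed subspaces, each almost orthogonal to the orthogonal complement of the other, have
close orthogonal projections. -/
theorem norm_projCl_sub_projCl_le {U W : Submodule ℂ H} (hU : IsClosed (U : Set H))
    (hW : IsClosed (W : Set H)) {δ : ℝ} (hδ : 0 ≤ δ)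
    (hUW : ∀ u ∈ U, ∀ v ∈ Wᗮ, ‖⟪u, v⟫‖ ≤ δ * ‖u‖ * ‖v‖)
    (hWU : ∀ u ∈ W, ∀ v ∈ Uᗮ, ‖⟪u, v⟫‖ ≤ δ * ‖u‖ * ‖v‖) :
    ‖projCl U hU - projCl W hW‖ ≤ 2 * δ := by
  refine ContinuousLinearMap.opNorm_le_bound _ (by positivity) fun x => ?_
  have h₁ : ‖projCl U hU x - projCl W hW (projCl U hU x)‖ ≤ δ * ‖x‖ := by
    set u := projCl U hU x with hu
    set v := u - projCl W hW u with hv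
    have hvm : v ∈ Wᗮ := sub_projCl_mem_orthogonal W hW u
    have h := hUW u (projCl_mem U hU x) v hvm
    have huv : ⟪u, v⟫ = ⟪v, v⟫ := by
      conv_rhs => rw [hv, inner_sub_left, ← hv, hvm _ (projCl_mem W hW u), sub_zero]
    rw [huv, inner_self_eq_norm_sq_to_K, norm_pow, RCLike.norm_ofReal, abs_norm] at h
    have hux : ‖u‖ ≤ ‖x‖ := norm_projCl_le U hU x
    rcases (norm_nonneg v).eq_or_lt with h0 | h0
    · rw [← h0]; positivity
    · have : ‖v‖ ≤ δ * ‖u‖ := by nlinarith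
      exact this.trans (by gcongr)
  have h₂ : ‖projCl W hW (x - projCl U hU x)‖ ≤ δ * ‖x‖ := by
    set y := x - projCl U hU x with hy
    set p := projCl W hW y with hp
    have h := hWU p (projCl_mem W hW y) y (sub_projCl_mem_orthogonal U hU x)
    have hpy : ⟪p, y⟫ = ⟪p, p⟫ := by
      have := sub_projCl_mem_orthogonal W hW y p (projCl_mem W hW y)
      rwa [inner_sub_right, sub_eq_zero] at this
    rw [hpy, inner_self_eq_norm_sq_to_K, norm_pow, RCLike.norm_ofReal, abs_norm] at h
    have hyx : ‖y‖ ≤ ‖x‖ := norm_sub_projCl_le U hU x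
    rcases (norm_nonneg p).eq_or_lt with h0 | h0
    · rw [← h0]; positivity
    · have : ‖p‖ ≤ δ * ‖y‖ := by nlinarith
      exact this.trans (by gcongr)
  have hsplit : (projCl U hU - projCl W hW) x = (projCl U hU x - projCl W hW (projCl U hU x))
      - projCl W hW (x - projCl U hU x) := by
    simp
  rw [hsplit]
  linarith [norm_sub_le (projCl U hU x - projCl W hW (projCl U hU x))
    (projCl W hW (x - projCl U hU x))]

theorem inner_sub_smul_of_mem_pKer_adjoint {A : H →ₗ.[ℂ] H} (hdense : Dense (A.domain : Set H))
    {z : ℂ} {u : H} (hu : u ∈ pKer A.adjoint z) (w : ℂ) (f : A.domain) :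
    ⟪u, A f - (starRingEnd ℂ w) • (f : H)⟫ = starRingEnd ℂ (z - w) * ⟪u, (f : H)⟫ := by
  obtain ⟨hu, hAu⟩ := hu
  have h := LinearPMap.adjoint_isFormalAdjoint hdense ⟨u, hu⟩ f
  rw [hAu, inner_smul_left] at h
  rw [inner_sub_right, inner_smul_right, ← h, map_sub]
  ring

theorem orthogonal_range_le_pKer_adjoint {A : H →ₗ.[ℂ] H} (hdense : Dense (A.domain : Set H))
    (w : ℂ) :
    (LinearMap.range (A.toFun - (starRingEnd ℂ w) • A.domain.subtype))ᗮ ≤ pKer A.adjoint w := by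
  intro u hu
  have h : ∀ x : A.domain, ⟪w • u, (x : H)⟫ = ⟪u, A x⟫ := fun x => by
    have hx := (Submodule.mem_orthogonal' _ _).1 hu _ (LinearMap.mem_range_self _ x)
    rw [LinearMap.sub_apply, inner_sub_right, sub_eq_zero] at hx
    rw [inner_smul_left, ← inner_smul_right]
    exact hx.symm
  exact ⟨LinearPMap.mem_adjoint_domain_of_exists u ⟨_, h⟩,
    LinearPMap.adjoint_apply_eq hdense _ h⟩

theorem norm_inner_le_of_mem_pKer_adjoint {A : H →ₗ.[ℂ] H} (hdense : Dense (A.domain : Set H))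
    {C : ℝ} {w : ℂ} (hbound : ∀ f : A.domain, ‖(f : H)‖ ≤ C * ‖A f - (starRingEnd ℂ w) • (f : H)‖)
    {z : ℂ} {u v : H} (hu : u ∈ pKer A.adjoint z) (hv : v ∈ (pKer A.adjoint w)ᗮ) :
    ‖⟪u, v⟫‖ ≤ C * ‖z - w‖ * ‖u‖ * ‖v‖ := by
  have hv' := Submodule.orthogonal_le (orthogonal_range_le_pKer_adjoint hdense w) hv
  rw [Submodule.orthogonal_orthogonal_eq_closure] at hv'
  have hcl : IsClosed {v : H | ‖⟪u, v⟫‖ ≤ C * ‖z - w‖ * ‖u‖ * ‖v‖} :=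
    isClosed_le (by fun_prop) (by fun_prop)
  refine closure_minimal ?_ hcl hv'
  rintro _ ⟨f, rfl⟩
  change ‖⟪u, A f - (starRingEnd ℂ w) • (f : H)⟫‖ ≤
    C * ‖z - w‖ * ‖u‖ * ‖A f - (starRingEnd ℂ w) • (f : H)‖
  rw [inner_sub_smul_of_mem_pKer_adjoint hdense hu, norm_mul, RCLike.norm_conj]
  calc ‖z - w‖ * ‖⟪u, (f : H)⟫‖ ≤ ‖z - w‖ * (‖u‖ * ‖(f : H)‖) := by
        gcongr; exact norm_inner_le_norm _ _
    _ ≤ ‖z - w‖ * (‖u‖ * (C * ‖A f - (starRingEnd ℂ w) • (f : H)‖)) := by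
        gcongr; exact hbound f
    _ = _ := by ring

theorem norm_le_norm_sub_smul_of_re_eq_zero {A : H →ₗ.[ℂ] H}
    (hsym : ∀ f g : A.domain, ⟪(f : H), (A g : H)⟫ = ⟪(A f : H), (g : H)⟫)
    {w : ℂ} (hw : w.re = 0) (f : A.domain) : ‖A f‖ ≤ ‖A f - w • (f : H)‖ := by
  have him : (⟪A f, (f : H)⟫).im = 0 := by
    exact Complex.conj_eq_iff_im.1 ((inner_conj_symm (f : H) (A f)).trans (hsym f f))
  have h := norm_sub_sq (𝕜 := ℂ) (A f) (w • (f : H))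
  have h0 : RCLike.re ⟪A f, w • (f : H)⟫ = 0 := by
    rw [inner_smul_right]
    simp [hw, him]
  rw [h0] at h
  nlinarith [norm_nonneg (A f), norm_nonneg (A f - w • (f : H)), sq_nonneg ‖w • (f : H)‖]

theorem tendsto_projCl_pKer_adjoint {A : H →ₗ.[ℂ] H} (hdense : Dense (A.domain : Set H))
    (hsym : ∀ f g : A.domain, ⟪(f : H), (A g : H)⟫ = ⟪(A f : H), (g : H)⟫)
    {C : ℝ} (hC : 0 ≤ C) (hbound : ∀ f : A.domain, ‖(f : H)‖ ≤ C * ‖A f‖)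
    (hker : ∀ z : ℂ, IsClosed ((pKer A.adjoint z : Set H))) {ι : Type*} {l : Filter ι}
    {z : ι → ℂ} (hz : ∀ i, (z i).re = 0) (hlim : Tendsto z l (nhds 0)) :
    Tendsto (fun i => projCl (pKer A.adjoint (z i)) (hker _)) l
      (nhds (projCl (pKer A.adjoint 0) (hker 0))) := by
  have hb : ∀ w : ℂ, w.re = 0 → ∀ f : A.domain,
      ‖(f : H)‖ ≤ C * ‖A f - (starRingEnd ℂ w) • (f : H)‖ := fun w hw f =>
    (hbound f).trans <| by
      gcongr
      exact norm_le_norm_sub_smul_of_re_eq_zero hsym (by simpa using hw) f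
  rw [tendsto_iff_norm_sub_tendsto_zero]
  refine squeeze_zero (g := fun i => 2 * (C * ‖z i‖)) (fun _ => norm_nonneg _) (fun i => ?_) ?_
  · refine norm_projCl_sub_projCl_le _ _ (by positivity) (fun u hu v hv => ?_) fun u hu v hv => ?_
    · simpa using norm_inner_le_of_mem_pKer_adjoint hdense (hb 0 rfl) hu hv
    · simpa using norm_inner_le_of_mem_pKer_adjoint hdense (hb _ (hz i)) hu hv
  · simpa using (hlim.norm.const_mul C).const_mul 2

theorem statement_3
    (A : H →ₗ.[ℂ] H)
    (hdense : Dense (A.domain : Set H))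
    (hclosed : A.IsClosed)
    (hsym : ∀ f g : A.domain, ⟪(f : H), (A g : H)⟫ = ⟪(A f : H), (g : H)⟫)
    (C : ℝ) (hC : 0 < C)
    (hbound : ∀ f : A.domain, ‖(f : H)‖ ≤ C * ‖A f‖)
    (hker : ∀ z : ℂ, IsClosed ((pKer A.adjoint z : Set H))) :
    Tendsto (fun ε : ℝ => projCl (pKer A.adjoint ((ε : ℂ) * I)) (hker _))
      (nhdsWithin 0 (Set.Ioi 0)) (nhds (projCl (pKer A.adjoint 0) (hker 0))) ∧
    Tendsto (fun ε : ℝ => projCl (pKer A.adjoint (-((ε : ℂ) * I))) (hker _))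
      (nhdsWithin 0 (Set.Ioi 0)) (nhds (projCl (pKer A.adjoint 0) (hker 0))) := by
  have h : Tendsto (fun ε : ℝ => (ε : ℂ) * I) (nhdsWithin 0 (Set.Ioi 0)) (nhds 0) := by
    have : Continuous fun ε : ℝ => (ε : ℂ) * I := by fun_prop
    simpa using (this.tendsto 0).mono_left nhdsWithin_le_nhds
  exact ⟨tendsto_projCl_pKer_adjoint hdense hsym hC.le hbound hker (by simp) h,
    tendsto_projCl_pKer_adjoint hdense hsym hC.le hbound hker (by simp) (by simpa using h.neg)⟩
end
end

section
/- Let ε > 0 and suppose g ∈ D(A*) decomposes both as g = f_ε + u_ε − v_ε with f_ε ∈ D(A), u_ε ∈ ker(A* − iε), v_ε ∈ ker(A* + iε), and as g = f + B u₁ + u₀ with f ∈ D(A), u₀, u₁ ∈ ker A*. Then ‖2iε·u_ε − u₁‖ ≤ ε·(‖g‖ + C·‖A* g‖) and ‖2iε·v_ε − u₁‖ ≤ ε·(‖g‖ + C·‖A* g‖). -/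
open Complex Filter
open scoped ComplexInnerProductSpace

noncomputable section

variable {H : Type*} [NormedAddCommGroup H] [InnerProductSpace ℂ H] [CompleteSpace H]

/-- The range of `A + z`. -/
def shiftRange (A : H →ₗ.[ℂ] H) (z : ℂ) : Submodule ℂ H :=
  LinearMap.range (A.toFun + z • A.domain.subtype)

theorem mem_shiftRange {E : Type*} [NormedAddCommGroup E] [InnerProductSpace ℂ E]
    (A : E →ₗ.[ℂ] E) (z : ℂ) (h : A.domain) :
    A h + z • (h : E) ∈ shiftRange A z := ⟨h, rfl⟩

theorem norm_apply_le_norm_apply_add_imaginary_smul {E : Type*} [NormedAddCommGroup E]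
    [InnerProductSpace ℂ E] {A : E →ₗ.[ℂ] E} (hA : A.IsFormalAdjoint A) (s : ℝ) (h : A.domain) :
    ‖A h‖ ≤ ‖A h + ((s : ℂ) * I) • (h : E)‖ := by
  have him : (⟪A h, (h : E)⟫).im = 0 := by
    rw [← Complex.conj_eq_iff_im, inner_conj_symm, hA h h]
  refine (sq_le_sq₀ (norm_nonneg _) (norm_nonneg _)).1 ?_
  have hre : (⟪A h, ((s : ℂ) * I) • (h : E)⟫).re = 0 := by
    rw [inner_smul_right]
    simp [him]
  have := norm_add_sq (𝕜 := ℂ) (A h) (((s : ℂ) * I) • (h : E))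
  simp only [RCLike.re_to_complex, hre] at this
  nlinarith [sq_nonneg ‖((s : ℂ) * I) • (h : E)‖]

theorem le_of_sq_le_mul {a c : ℝ} (ha : 0 ≤ a) (hc : 0 ≤ c) (h : a ^ 2 ≤ c * a) :
    a ≤ c := by
  rcases ha.eq_or_lt with rfl | ha
  · exact hc
  · exact le_of_mul_le_mul_right (by rwa [sq] at h) ha

/-- The projection onto `(ran (A + is))ᗮ` is small on `ran A`. -/
theorem norm_starProjection_apply_range_le {A : H →ₗ.[ℂ] H} {C : ℝ}
    (hbound : ∀ f : A.domain, ‖(f : H)‖ ≤ C * ‖A f‖) (s : ℝ) (f : A.domain) :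
    ‖(shiftRange A ((s : ℂ) * I))ᗮ.starProjection (A f)‖ ≤ |s| * C * ‖A f‖ := by
  set K := (shiftRange A ((s : ℂ) * I))ᗮ
  set w := K.starProjection (A f)
  have hw : w ∈ K := K.starProjection_apply_mem _
  have hf : ⟪A f, w⟫ + ⟪((s : ℂ) * I) • (f : H), w⟫ = 0 := by
    rw [← inner_add_left]
    exact (Submodule.mem_orthogonal _ _).1 hw _ (mem_shiftRange A _ f)
  have hww : ⟪w, w⟫ = ⟪A f, w⟫ := by
    have := K.starProjection_inner_eq_zero (A f) w hw
    rw [inner_sub_left, sub_eq_zero] at this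
    exact this.symm
  have hC : 0 ≤ C * ‖A f‖ := (norm_nonneg _).trans (hbound f)
  refine le_of_sq_le_mul (norm_nonneg _) (by rw [mul_assoc]; positivity) ?_
  calc ‖w‖ ^ 2 = ‖⟪w, w⟫‖ := by rw [inner_self_eq_norm_sq_to_K]; simp
    _ = ‖⟪((s : ℂ) * I) • (f : H), w⟫‖ := by
      rw [hww, eq_neg_of_add_eq_zero_left hf, norm_neg]
    _ ≤ ‖((s : ℂ) * I) • (f : H)‖ * ‖w‖ := norm_inner_le_norm _ _
    _ = |s| * ‖(f : H)‖ * ‖w‖ := by simp [norm_smul]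
    _ ≤ |s| * C * ‖A f‖ * ‖w‖ := by
      rw [mul_assoc |s| C]
      gcongr
      exact hbound f

/-- The projection onto `(ran (A + is))ᗮ` almost fixes `(ran A)ᗮ`. -/
theorem norm_sub_starProjection_le {A : H →ₗ.[ℂ] H} (hA : A.IsFormalAdjoint A) {C : ℝ}
    (hC : 0 ≤ C) (hbound : ∀ f : A.domain, ‖(f : H)‖ ≤ C * ‖A f‖) (s : ℝ) {u : H}
    (hu : ∀ h : A.domain, ⟪A h, u⟫ = 0) :
    ‖u - (shiftRange A ((s : ℂ) * I))ᗮ.starProjection u‖ ≤ |s| * C * ‖u‖ := by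
  set R := shiftRange A ((s : ℂ) * I)
  set r := u - Rᗮ.starProjection u
  have hr : r ∈ closure (R : Set H) := by
    rw [← Submodule.topologicalClosure_coe, ← Submodule.orthogonal_orthogonal_eq_closure]
    exact Rᗮ.sub_starProjection_mem_orthogonal u
  have hrr : ⟪r, r⟫ = ⟪r, u⟫ := by
    have h : ⟪r, Rᗮ.starProjection u⟫ = 0 :=
      Rᗮ.starProjection_inner_eq_zero u _ (Rᗮ.starProjection_apply_mem u)
    calc ⟪r, r⟫ = ⟪r, u⟫ - ⟪r, Rᗮ.starProjection u⟫ := inner_sub_right _ _ _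
      _ = ⟪r, u⟫ := by rw [h, sub_zero]
  have hclosed : IsClosed {y : H | ‖⟪y, u⟫‖ ≤ |s| * C * ‖u‖ * ‖y‖} :=
    isClosed_le (by fun_prop) (by fun_prop)
  have hR : (R : Set H) ⊆ {y : H | ‖⟪y, u⟫‖ ≤ |s| * C * ‖u‖ * ‖y‖} := by
    rintro _ ⟨h, rfl⟩
    change ‖⟪A h + ((s : ℂ) * I) • (h : H), u⟫‖ ≤
      |s| * C * ‖u‖ * ‖A h + ((s : ℂ) * I) • (h : H)‖
    calc ‖⟪A h + ((s : ℂ) * I) • (h : H), u⟫‖ = ‖⟪((s : ℂ) * I) • (h : H), u⟫‖ := by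
          rw [inner_add_left, hu, zero_add]
      _ ≤ ‖((s : ℂ) * I) • (h : H)‖ * ‖u‖ := norm_inner_le_norm _ _
      _ = |s| * ‖(h : H)‖ * ‖u‖ := by simp [norm_smul]
      _ ≤ |s| * (C * ‖A h + ((s : ℂ) * I) • (h : H)‖) * ‖u‖ := by
          gcongr
          exact (hbound h).trans (mul_le_mul_of_nonneg_left
            (norm_apply_le_norm_apply_add_imaginary_smul hA s h) hC)
      _ = _ := by ring
  refine le_of_sq_le_mul (norm_nonneg _) (by positivity) ?_
  calc ‖r‖ ^ 2 = ‖⟪r, r⟫‖ := by rw [inner_self_eq_norm_sq_to_K]; simp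
    _ = ‖⟪r, u⟫‖ := by rw [hrr]
    _ ≤ _ := closure_minimal hR hclosed hr

/-- The projections onto `(ran (A + is))ᗮ` and `(ran A)ᗮ` differ by at most `|s| * C`. -/
theorem norm_starProjection_add_sub_le {A : H →ₗ.[ℂ] H} (hA : A.IsFormalAdjoint A) {C : ℝ}
    (hC : 0 ≤ C) (hbound : ∀ f : A.domain, ‖(f : H)‖ ≤ C * ‖A f‖) (s : ℝ) (f : A.domain) {u : H}
    (hu : ∀ h : A.domain, ⟪A h, u⟫ = 0) :
    ‖(shiftRange A ((s : ℂ) * I))ᗮ.starProjection (A f + u) - u‖ ≤ |s| * C * ‖A f + u‖ := by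
  set K := (shiftRange A ((s : ℂ) * I))ᗮ
  have h1 : ‖K.starProjection (A f)‖ ≤ |s| * C * ‖A f‖ :=
    norm_starProjection_apply_range_le hbound s f
  have h2 : ‖u - K.starProjection u‖ ≤ |s| * C * ‖u‖ := norm_sub_starProjection_le hA hC hbound s hu
  have hsplit : K.starProjection (A f + u) - u =
      K.starProjection (A f) - (u - K.starProjection u) := by
    rw [map_add]; abel
  have horth : ⟪K.starProjection (A f), u - K.starProjection u⟫ = 0 :=
    (Submodule.mem_orthogonal _ _).1 (K.sub_starProjection_mem_orthogonal u) _
      (K.starProjection_apply_mem _)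
  have e1 : ‖K.starProjection (A f) - (u - K.starProjection u)‖ ^ 2 =
      ‖K.starProjection (A f)‖ ^ 2 + ‖u - K.starProjection u‖ ^ 2 := by
    rw [norm_sub_sq (𝕜 := ℂ), horth]; simp
  have e2 : ‖A f + u‖ ^ 2 = ‖A f‖ ^ 2 + ‖u‖ ^ 2 := by
    rw [norm_add_sq (𝕜 := ℂ), hu]; simp
  refine (sq_le_sq₀ (norm_nonneg _) (by positivity)).1 ?_
  rw [hsplit, e1, mul_pow, e2, mul_add, ← mul_pow, ← mul_pow]
  gcongr

theorem mem_shiftRange_orthogonal {A : H →ₗ.[ℂ] H} (hdense : Dense (A.domain : Set H)) {s : ℝ}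
    {u : H} (hu : u ∈ pKer A.adjoint ((s : ℂ) * I)) : u ∈ (shiftRange A ((s : ℂ) * I))ᗮ := by
  obtain ⟨hu, hAu⟩ := hu
  rw [Submodule.mem_orthogonal']
  rintro _ ⟨h, rfl⟩
  change ⟪u, A h + ((s : ℂ) * I) • (h : H)⟫ = 0
  have := LinearPMap.adjoint_isFormalAdjoint hdense ⟨u, hu⟩ h
  rw [hAu, inner_smul_left] at this
  rw [inner_add_right, inner_smul_right, ← this]
  simp

theorem norm_two_mul_smul_sub_le {A : H →ₗ.[ℂ] H} (hdense : Dense (A.domain : Set H))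
    (hA : A.IsFormalAdjoint A) {C : ℝ} (hC : 0 ≤ C)
    (hbound : ∀ f : A.domain, ‖(f : H)‖ ≤ C * ‖A f‖) (s : ℝ) (g : A.adjoint.domain)
    (k : A.domain) {u v : H} (hu : u ∈ pKer A.adjoint ((s : ℂ) * I))
    (hv : v ∈ pKer A.adjoint (-((s : ℂ) * I))) (hg : (g : H) = k + u - v)
    (f : A.domain) {u₁ : H} (hu₁ : ∀ h : A.domain, ⟪A h, u₁⟫ = 0)
    (hAg : A.adjoint g = A f + u₁) :
    ‖(2 * (s : ℂ) * I) • u - u₁‖ ≤ |s| * (‖(g : H)‖ + C * ‖A.adjoint g‖) := by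
  set K := (shiftRange A ((s : ℂ) * I))ᗮ
  have huK : u ∈ K := mem_shiftRange_orthogonal hdense hu
  obtain ⟨hu, hAu⟩ := hu
  obtain ⟨hv, hAv⟩ := hv
  have hle : A ≤ A.adjoint := LinearPMap.IsFormalAdjoint.le_adjoint hdense hA
  have hAg' : A.adjoint g = A k + ((s : ℂ) * I) • u + ((s : ℂ) * I) • v := by
    have hgk : g = ⟨k, hle.1 k.2⟩ + ⟨u, hu⟩ - ⟨v, hv⟩ := Subtype.ext hg
    rw [hgk, LinearPMap.map_sub, LinearPMap.map_add, hAu, hAv, ← hle.2 (x := k) rfl, neg_smul,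
      sub_neg_eq_add]
  have hP : K.starProjection (A.adjoint g + ((s : ℂ) * I) • (g : H)) = (2 * (s : ℂ) * I) • u := by
    refine K.eq_starProjection_of_mem_orthogonal (K.smul_mem _ huK) ?_
    have hsum : A.adjoint g + ((s : ℂ) * I) • (g : H) - (2 * (s : ℂ) * I) • u =
        A k + ((s : ℂ) * I) • (k : H) := by
      rw [hAg', hg]; module
    rw [hsum]
    exact Submodule.le_orthogonal_orthogonal _ (mem_shiftRange A _ k)
  rw [← hP, map_add, map_smul, add_sub_right_comm, mul_add, add_comm (|s| * _)]
  refine (norm_add_le _ _).trans (add_le_add ?_ ?_)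
  · rw [hAg, ← mul_assoc]
    exact norm_starProjection_add_sub_le hA hC hbound s f hu₁
  · rw [norm_smul]
    simpa using mul_le_mul_of_nonneg_left (K.norm_starProjection_apply_le (g : H)) (abs_nonneg s)

theorem statement_13
    (A : H →ₗ.[ℂ] H)
    (hdense : Dense (A.domain : Set H))
    (hclosed : A.IsClosed)
    (hsym : ∀ f g : A.domain, ⟪(f : H), (A g : H)⟫ = ⟪(A f : H), (g : H)⟫)
    (C : ℝ) (hC : 0 < C)
    (hbound : ∀ f : A.domain, ‖(f : H)‖ ≤ C * ‖A f‖)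
    (hker : ∀ z : ℂ, IsClosed ((pKer A.adjoint z : Set H)))
    (SD : H →ₗ.[ℂ] H) (hSDsa : SD.adjoint = SD) (hASD : A ≤ SD)
    (B : H →L[ℂ] H) (b : ℝ) (hb : ‖B‖ = b)
    (hB1 : ∀ x : SD.domain, B (SD x) = x)
    (hB2 : ∀ y : H, ∃ hy : B y ∈ SD.domain, SD ⟨B y, hy⟩ = y)
    (ε : ℝ) (hε : 0 < ε) (g : A.adjoint.domain)
    (fε : A.domain) (uε vε : H)
    (huε : uε ∈ pKer A.adjoint ((ε : ℂ) * I))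
    (hvε : vε ∈ pKer A.adjoint (-((ε : ℂ) * I)))
    (hgε : (g : H) = (fε : H) + uε - vε)
    (f : A.domain) (u₀ u₁ : H)
    (hu₀ : u₀ ∈ pKer A.adjoint 0) (hu₁ : u₁ ∈ pKer A.adjoint 0)
    (hg : (g : H) = (f : H) + B u₁ + u₀) :
    ‖(2 * (ε : ℂ) * I) • uε - u₁‖ ≤ ε * (‖(g : H)‖ + C * ‖A.adjoint g‖) ∧
    ‖(2 * (ε : ℂ) * I) • vε - u₁‖ ≤ ε * (‖(g : H)‖ + C * ‖A.adjoint g‖) := by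
  have hA : A.IsFormalAdjoint A := fun x y => (hsym x y).symm
  have hadj := LinearPMap.adjoint_isFormalAdjoint hdense
  have hSD : SD.IsFormalAdjoint SD := by
    have h := LinearPMap.adjoint_isFormalAdjoint (T := SD) (hdense.mono hASD.1)
    rwa [hSDsa] at h
  have hSDle : SD ≤ A.adjoint := LinearPMap.IsFormalAdjoint.le_adjoint hdense fun x y => by
    have h := hSD ⟨x, hASD.1 x.2⟩ y
    rwa [← hASD.2 (x := x) rfl] at h
  have hle : A ≤ A.adjoint := hASD.trans hSDle
  obtain ⟨hu₀, hAu₀⟩ := hu₀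
  obtain ⟨hB, hSB⟩ := hB2 u₁
  have hAg : A.adjoint g = A f + u₁ := by
    have hgf : g = ⟨f, hle.1 f.2⟩ + ⟨B u₁, hSDle.1 hB⟩ + ⟨u₀, hu₀⟩ := Subtype.ext hg
    rw [hgf, LinearPMap.map_add, LinearPMap.map_add, hAu₀, ← hle.2 (x := f) rfl,
      ← hSDle.2 (x := ⟨B u₁, hB⟩) rfl, hSB, zero_smul, add_zero]
  have horth : ∀ h : A.domain, ⟪A h, u₁⟫ = 0 := fun h => by
    obtain ⟨hu₁, hAu₁⟩ := hu₁
    rw [hadj.symm h ⟨u₁, hu₁⟩, hAu₁, zero_smul, inner_zero_right]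
  constructor
  · simpa only [abs_of_pos hε] using
      norm_two_mul_smul_sub_le hdense hA hC.le hbound ε g fε huε hvε hgε f horth hAg
  · have h := norm_two_mul_smul_sub_le hdense hA hC.le hbound (-ε) g fε (u := -vε) (v := -uε)
      (Submodule.neg_mem _ (by simpa using hvε)) (Submodule.neg_mem _ (by simpa using huε))
      (by rw [hgε]; abel) f horth hAg
    simpa [abs_of_pos hε] using h
end
end
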